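/- arXiv:2012.10344 — 2 statements merged into one kernel-verified Lean document; each statement's English description precedes it below -/
import Mathlib

section
/- There exists a constant C > 0 such that for every f ∈ H¹(𝕋²) and every q > 2, ‖f‖_{L^q(𝕋²)} ≤ C √q ‖f‖_{H¹(𝕋²)}. -/
open MeasureTheory

/-- `L^p` norm of a function on the 2-torus, realized as a ℤ²-periodic function on
`ℝ × ℝ` with norms computed over the fundamental domain `[0,1]²`. -/
noncomputable def T2LpNorm (p : ℝ) (f : ℝ × ℝ → ℝ) : ℝ :=
  (∫ x in Set.Icc ((0 : ℝ), (0 : ℝ)) (1, 1), |f x| ^ p) ^ (1 / p)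

/-- `H¹` norm on the 2-torus. -/
noncomputable def T2H1Norm (f : ℝ × ℝ → ℝ) : ℝ :=
  Real.sqrt (∫ x in Set.Icc ((0 : ℝ), (0 : ℝ)) (1, 1), (|f x| ^ 2 + ‖fderiv ℝ f x‖ ^ 2))

/-- ℤ²-periodicity, i.e. `f` descends to the torus `𝕋²`. -/
def T2Periodic (f : ℝ × ℝ → ℝ) : Prop :=
  ∀ x : ℝ × ℝ, f (x.1 + 1, x.2) = f x ∧ f (x.1, x.2 + 1) = f x

lemma kernel_bound (r : ℝ) (h0 : 0 < r) (h2 : r < 2) :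
    ∫⁻ w : ℝ × ℝ in Metric.closedBall 0 1, (ENNReal.ofReal ‖w‖⁻¹) ^ r ≤ ENNReal.ofReal (8 / (2 - r)) := by
  set h : ℝ → ℝ := (Set.Iic 1).indicator (fun y => (y⁻¹) ^ r) with hh
  have hpt : ∀ y ∈ Set.Ioi (0:ℝ), y ^ (Module.finrank ℝ (ℝ × ℝ) - 1) • h y
      = (Set.Ioc (0:ℝ) 1).indicator (fun y => y ^ (1 - r)) y := by
    intro y hy
    have hy' : 0 < y := hy
    by_cases h1 : y ≤ 1
    · rw [Set.indicator_of_mem (show y ∈ Set.Ioc (0:ℝ) 1 from ⟨hy', h1⟩), hh,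
        Set.indicator_of_mem (show y ∈ Set.Iic (1:ℝ) from h1)]
      simp only [Module.finrank_prod, Module.finrank_self, smul_eq_mul]
      norm_num
      rw [Real.inv_rpow hy'.le, Real.rpow_sub hy', Real.rpow_one, div_eq_mul_inv]
    · rw [Set.indicator_of_notMem (fun hm => h1 hm.2), hh,
        Set.indicator_of_notMem (show y ∉ Set.Iic (1:ℝ) from h1)]
      simp
  have hint1 : IntegrableOn (fun y : ℝ => y ^ (1 - r)) (Set.Ioc (0:ℝ) 1) := by
    have := intervalIntegral.intervalIntegrable_rpow' (a := 0) (b := 1) (r := 1 - r) (by linarith)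
    rwa [intervalIntegrable_iff_integrableOn_Ioc_of_le zero_le_one] at this
  have hint : Integrable (fun w : ℝ × ℝ => h ‖w‖) := by
    rw [integrable_fun_norm_addHaar]
    rw [integrableOn_congr_fun hpt measurableSet_Ioi]
    exact (hint1.integrable_indicator measurableSet_Ioc).integrableOn
  have hval : ∫ w : ℝ × ℝ, h ‖w‖ = 8 / (2 - r) := by
    rw [integral_fun_norm_addHaar, setIntegral_congr_fun measurableSet_Ioi hpt,
      setIntegral_indicator measurableSet_Ioc,
      Set.inter_eq_right.2 (fun y hy => hy.1), ← intervalIntegral.integral_of_le zero_le_one,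
      integral_rpow (Or.inl (by linarith))]
    have hb : (volume : Measure (ℝ × ℝ)).real (Metric.ball 0 1) = 4 := by
      rw [← Prod.mk_zero_zero, ← ball_prod_same, Measure.volume_eq_prod, measureReal_prod_prod,
        Real.volume_real_ball zero_le_one]
      norm_num
    rw [hb]
    have : 2 - r ≠ 0 := by linarith
    have h3 : 1 - r + 1 = 2 - r := by ring
    rw [h3, Real.zero_rpow this]
    simp
    ring
  have hnn : ∀ w : ℝ × ℝ, 0 ≤ h ‖w‖ := fun w =>
    Set.indicator_apply_nonneg (fun _ => by positivity)
  rw [← hval, ofReal_integral_eq_lintegral_ofReal hint (Filter.Eventually.of_forall hnn),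
    ← lintegral_indicator Metric.isClosed_closedBall.measurableSet]
  refine lintegral_mono fun w => ?_
  by_cases hw : w ∈ Metric.closedBall (0 : ℝ × ℝ) 1
  · rw [Set.indicator_of_mem hw, hh]
    rw [mem_closedBall_zero_iff] at hw
    simp only
    rw [Set.indicator_of_mem (show ‖w‖ ∈ Set.Iic (1:ℝ) from hw),
      ENNReal.ofReal_rpow_of_nonneg (by positivity) h0.le]
  · rw [Set.indicator_of_notMem hw]; exact zero_le

lemma inner_bound (a : ℝ) (ha : 0 < a) :
    ∫⁻ t in Set.Ioc (0:ℝ) 1, (Set.Ici a).indicator (fun t => ENNReal.ofReal (t⁻¹ ^ 3)) t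
      ≤ ENNReal.ofReal (a⁻¹ ^ 2) := by
  calc _ ≤ ∫⁻ t, (Set.Ici a).indicator (fun t => ENNReal.ofReal (t⁻¹ ^ 3)) t :=
        lintegral_mono' Measure.restrict_le_self le_rfl
    _ = ∫⁻ t in Set.Ioi a, ENNReal.ofReal (t⁻¹ ^ 3) := by
        rw [lintegral_indicator measurableSet_Ici, restrict_Ioi_eq_restrict_Ici]
    _ = ∫⁻ t in Set.Ioi a, ENNReal.ofReal (t ^ (-3 : ℝ)) := by
        refine setLIntegral_congr_fun measurableSet_Ioi fun t ht => ?_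
        have : 0 < t := ha.trans ht
        rw [Real.rpow_neg this.le, inv_pow]
        norm_cast
    _ = ENNReal.ofReal (∫ t in Set.Ioi a, t ^ (-3 : ℝ)) := by
        rw [ofReal_integral_eq_lintegral_ofReal (integrableOn_Ioi_rpow_of_lt (by norm_num) ha)]
        filter_upwards [ae_restrict_mem measurableSet_Ioi] with t ht
        have : 0 < t := ha.trans ht
        simp only [Pi.zero_apply]
        positivity
    _ ≤ _ := by
        apply ENNReal.ofReal_le_ofReal
        rw [integral_Ioi_rpow_of_lt (by norm_num) ha]
        have : a ^ (-3 + 1 : ℝ) = a⁻¹ ^ 2 := by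
          norm_num
        rw [this]
        have : 0 ≤ a⁻¹ ^ 2 := by positivity
        norm_num at *
        linarith

lemma scale_lint (h : ℝ × ℝ → ENNReal) (hm : Measurable h) (x : ℝ × ℝ) (t : ℝ) (ht : 0 < t) :
    ∫⁻ y, h (x + t • (y - x)) = ENNReal.ofReal (t⁻¹ ^ 2) * ∫⁻ z, h z := by
  have e1 : ∫⁻ y, h (x + t • (y - x)) = ∫⁻ y, h (x + t • y) :=
    lintegral_sub_right_eq_self (fun y => h (x + t • y)) x
  have e2 : ∫⁻ z, h z = ∫⁻ z, h (x + z) := (lintegral_add_left_eq_self h x).symm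
  have hm' : Measurable (fun z => h (x + z)) := hm.comp (measurable_const_add x)
  rw [e1, e2, ← lintegral_map (μ := volume) hm' (measurable_const_smul t),
    Measure.map_addHaar_smul _ ht.ne', lintegral_smul_measure, smul_eq_mul]
  congr 2
  rw [abs_of_nonneg (by positivity)]
  simp

lemma potential (g : ℝ × ℝ → ENNReal) (hg : Measurable g) (x : ℝ × ℝ)
    (hx : x ∈ Set.Icc ((0 : ℝ), (0 : ℝ)) (1, 1)) :
    ∫⁻ y in Set.Icc ((0 : ℝ), (0 : ℝ)) (1, 1), ∫⁻ t in Set.Ioc (0:ℝ) 1,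
      g (x + t • (y - x)) * ENNReal.ofReal ‖y - x‖
    ≤ ∫⁻ z in Set.Icc ((0 : ℝ), (0 : ℝ)) (1, 1), g z * ENNReal.ofReal ‖z - x‖⁻¹ := by
  set S := Set.Icc ((0 : ℝ), (0 : ℝ)) (1, 1) with hS
  have hSm : MeasurableSet S := measurableSet_Icc
  have hdiam : ∀ y ∈ S, ‖y - x‖ ≤ 1 := by
    rintro ⟨y1, y2⟩ ⟨⟨a1, a2⟩, ⟨a3, a4⟩⟩
    obtain ⟨x1, x2⟩ := x
    obtain ⟨⟨b1, b2⟩, ⟨b3, b4⟩⟩ := hx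
    simp only at a1 a2 a3 a4 b1 b2 b3 b4
    rw [Prod.mk_sub_mk, Prod.norm_mk]
    apply max_le <;> rw [Real.norm_eq_abs, abs_le] <;> constructor <;> linarith
  have hconv : Convex ℝ S := convex_Icc _ _
  set H : ℝ → ℝ × ℝ → ENNReal := fun t z =>
    S.indicator g z * ENNReal.ofReal (‖z - x‖ * t⁻¹) * (if ‖z - x‖ ≤ t then 1 else 0) with hH
  have hHm : Measurable (fun p : ℝ × (ℝ × ℝ) => H p.1 p.2) := by
    apply Measurable.mul
    · apply Measurable.mul
      · exact (hg.indicator hSm).comp measurable_snd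
      · fun_prop
    · refine Measurable.ite ?_ measurable_const measurable_const
      exact measurableSet_le (by fun_prop) (by fun_prop)
  have hgm : Measurable (fun p : (ℝ × ℝ) × ℝ => g (x + p.2 • (p.1 - x)) * ENNReal.ofReal ‖p.1 - x‖) := by
    apply Measurable.mul
    · exact hg.comp (by fun_prop)
    · fun_prop
  rw [lintegral_lintegral_swap hgm.aemeasurable]
  have step : ∀ t ∈ Set.Ioc (0:ℝ) 1, ∫⁻ y in S, g (x + t • (y - x)) * ENNReal.ofReal ‖y - x‖
      ≤ ∫⁻ z, ENNReal.ofReal (t⁻¹ ^ 2) * H t z := by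
    intro t ht
    have hHt : Measurable (H t) := hHm.comp measurable_prodMk_left
    rw [lintegral_const_mul _ hHt, ← scale_lint (H t) hHt x t ht.1]
    rw [← lintegral_indicator hSm]
    refine lintegral_mono fun y => ?_
    by_cases hy : y ∈ S
    · rw [Set.indicator_of_mem hy, hH]
      have hz : x + t • (y - x) ∈ S := hconv.add_smul_sub_mem hx hy ⟨ht.1.le, ht.2⟩
      simp only [add_sub_cancel_left]
      rw [Set.indicator_of_mem hz, norm_smul, Real.norm_of_nonneg ht.1.le]
      rw [if_pos (by nlinarith [hdiam y hy, ht.1]), mul_one]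
      have : t * ‖y - x‖ * t⁻¹ = ‖y - x‖ := by field_simp [ht.1.ne']
      rw [this]
    · rw [Set.indicator_of_notMem hy]; exact zero_le
  calc _ ≤ ∫⁻ t in Set.Ioc (0:ℝ) 1, ∫⁻ z, ENNReal.ofReal (t⁻¹ ^ 2) * H t z :=
        setLIntegral_mono' measurableSet_Ioc step
    _ = ∫⁻ z, ∫⁻ t in Set.Ioc (0:ℝ) 1, ENNReal.ofReal (t⁻¹ ^ 2) * H t z := by
        rw [lintegral_lintegral_swap]
        apply Measurable.aemeasurable
        exact Measurable.mul (by fun_prop) hHm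
    _ ≤ ∫⁻ z, S.indicator (fun z => g z * ENNReal.ofReal ‖z - x‖⁻¹) z := by
        refine lintegral_mono fun z => ?_
        by_cases hz : z ∈ S
        swap
        · simp [hH, Set.indicator_of_notMem hz]
        simp only [hH, Set.indicator_of_mem hz]
        rcases eq_or_ne z x with rfl | hne
        · simp
        have hpos : 0 < ‖z - x‖ := norm_pos_iff.2 (sub_ne_zero.2 hne)
        calc _ = ∫⁻ t in Set.Ioc (0:ℝ) 1, (g z * ENNReal.ofReal ‖z - x‖) *
              (Set.Ici ‖z - x‖).indicator (fun t => ENNReal.ofReal (t⁻¹ ^ 3)) t := by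
              refine setLIntegral_congr_fun measurableSet_Ioc fun t ht => ?_
              simp only [Set.indicator_apply, Set.mem_Ici]
              split_ifs
              · rw [ENNReal.ofReal_mul hpos.le, mul_one]
                have : t⁻¹ ^ 3 = t⁻¹ ^ 2 * t⁻¹ := by ring
                rw [this, ENNReal.ofReal_mul (by positivity)]
                ring
              · simp
          _ = (g z * ENNReal.ofReal ‖z - x‖) * ∫⁻ t in Set.Ioc (0:ℝ) 1,
              (Set.Ici ‖z - x‖).indicator (fun t => ENNReal.ofReal (t⁻¹ ^ 3)) t := by
              rw [lintegral_const_mul]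
              exact Measurable.indicator (by fun_prop) measurableSet_Ici
          _ ≤ (g z * ENNReal.ofReal ‖z - x‖) * ENNReal.ofReal (‖z - x‖⁻¹ ^ 2) := by
              gcongr
              exact inner_bound _ hpos
          _ = _ := by
              rw [mul_assoc, ← ENNReal.ofReal_mul hpos.le]
              congr 2
              field_simp
    _ = _ := by rw [lintegral_indicator hSm]

lemma kernel_translate (r : ℝ) (h0 : 0 < r) (h2 : r < 2) (x : ℝ × ℝ)
    (hx : x ∈ Set.Icc ((0 : ℝ), (0 : ℝ)) (1, 1)) :
    ∫⁻ z in Set.Icc ((0 : ℝ), (0 : ℝ)) (1, 1), (ENNReal.ofReal ‖z - x‖⁻¹) ^ r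
      ≤ ENNReal.ofReal (8 / (2 - r)) := by
  refine le_trans ?_ (kernel_bound r h0 h2)
  rw [← lintegral_indicator measurableSet_Icc,
    ← lintegral_indicator Metric.isClosed_closedBall.measurableSet,
    ← lintegral_sub_right_eq_self
      ((Metric.closedBall (0 : ℝ × ℝ) 1).indicator fun w => ENNReal.ofReal ‖w‖⁻¹ ^ r) x]
  refine lintegral_mono fun z => ?_
  by_cases hz : z ∈ Set.Icc ((0 : ℝ), (0 : ℝ)) (1, 1)
  · have : z - x ∈ Metric.closedBall (0 : ℝ × ℝ) 1 := by
      rw [mem_closedBall_zero_iff]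
      obtain ⟨z1, z2⟩ := z
      obtain ⟨x1, x2⟩ := x
      obtain ⟨⟨a1, a2⟩, ⟨a3, a4⟩⟩ := hz
      obtain ⟨⟨b1, b2⟩, ⟨b3, b4⟩⟩ := hx
      simp only at a1 a2 a3 a4 b1 b2 b3 b4
      rw [Prod.mk_sub_mk, Prod.norm_mk]
      apply max_le <;> rw [Real.norm_eq_abs, abs_le] <;> constructor <;> linarith
    rw [Set.indicator_of_mem hz, Set.indicator_of_mem this]
  · rw [Set.indicator_of_notMem hz]; exact zero_le

lemma young_bound (g : ℝ × ℝ → ENNReal) (hg : Measurable g) (q : ℝ) (hq : 2 < q) :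
    (∫⁻ x in Set.Icc ((0 : ℝ), (0 : ℝ)) (1, 1),
      (∫⁻ z in Set.Icc ((0 : ℝ), (0 : ℝ)) (1, 1), g z * ENNReal.ofReal ‖z - x‖⁻¹) ^ q) ^ (1 / q)
    ≤ ENNReal.ofReal (4 * q) ^ (1 / 2 + 1 / q : ℝ) *
      (∫⁻ z in Set.Icc ((0 : ℝ), (0 : ℝ)) (1, 1), g z ^ (2:ℝ)) ^ (1 / 2 : ℝ) := by
  set S := Set.Icc ((0 : ℝ), (0 : ℝ)) (1, 1) with hS
  have hSm : MeasurableSet S := measurableSet_Icc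
  have hq0 : 0 < q := by linarith
  set r : ℝ := 2 * q / (q + 2) with hr
  have hr0 : 0 < r := by positivity
  have hr2 : r < 2 := by rw [hr, div_lt_iff₀ (by linarith)]; linarith
  have hA : 8 / (2 - r) ≤ 4 * q := by
    have : 2 - r = 4 / (q + 2) := by rw [hr]; field_simp; ring
    rw [this]
    field_simp
    linarith
  set A : ENNReal := ENNReal.ofReal (4 * q) with hAdef
  have hker : ∀ x ∈ S, ∫⁻ z in S, (ENNReal.ofReal ‖z - x‖⁻¹) ^ r ≤ A := fun x hx =>
    (kernel_translate r hr0 hr2 x hx).trans (ENNReal.ofReal_le_ofReal hA)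
  set G := ∫⁻ z in S, g z ^ (2:ℝ) with hG
  have hKm : Measurable (fun p : (ℝ × ℝ) × (ℝ × ℝ) => (ENNReal.ofReal ‖p.2 - p.1‖⁻¹) ^ r) := by
    fun_prop
  have e1 : r / q + r / 2 = 1 := by rw [hr]; field_simp; ring
  have hq1 : 0 ≤ 1 / 2 - 1 / q := by
    have : 1 / q ≤ 1 / 2 := one_div_le_one_div_of_le (by norm_num) hq.le
    linarith
  -- Hölder
  have hold : ∀ x ∈ S, ∫⁻ z in S, g z * ENNReal.ofReal ‖z - x‖⁻¹ ≤
      (∫⁻ z in S, (ENNReal.ofReal ‖z - x‖⁻¹) ^ r * g z ^ (2:ℝ)) ^ (1 / q) * A ^ (1 / 2 : ℝ)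
        * G ^ (1 / 2 - 1 / q) := by
    intro x hx
    have hK : Measurable (fun z => (ENNReal.ofReal ‖z - x‖⁻¹) ^ r) := by fun_prop
    have hg2 : Measurable (fun z => g z ^ (2:ℝ)) := by fun_prop
    have := ENNReal.lintegral_prod_norm_pow_le (μ := volume.restrict S) (Finset.univ : Finset (Fin 3))
      (f := ![fun z => (ENNReal.ofReal ‖z - x‖⁻¹) ^ r * g z ^ (2:ℝ),
        fun z => (ENNReal.ofReal ‖z - x‖⁻¹) ^ r, fun z => g z ^ (2:ℝ)])
      (p := ![1 / q, 1 / 2, 1 / 2 - 1 / q])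
      (by
        intro i _
        fin_cases i
        · exact (hK.mul hg2).aemeasurable
        · exact hK.aemeasurable
        · exact hg2.aemeasurable)
      (by simp [Fin.sum_univ_three]; ring)
      (by
        intro i _
        fin_cases i
        · simp; positivity
        · simp
        · simpa using hq1)
    simp only [Fin.prod_univ_three, Matrix.cons_val_zero, Matrix.cons_val_one, Matrix.cons_val] at this
    refine le_trans (le_of_eq ?_) (this.trans ?_)
    · refine lintegral_congr fun z => ?_
      set k := ENNReal.ofReal ‖z - x‖⁻¹
      rw [ENNReal.mul_rpow_of_nonneg _ _ (by positivity), ← ENNReal.rpow_mul, ← ENNReal.rpow_mul,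
        ← ENNReal.rpow_mul, ← ENNReal.rpow_mul]
      have h1 : k ^ (r * (1 / q)) * k ^ (r * (1 / 2)) = k := by
        rw [← ENNReal.rpow_add_of_nonneg _ _ (by positivity) (by positivity)]
        have : r * (1 / q) + r * (1 / 2) = 1 := by linarith [e1, show r * (1 / q) = r / q by ring]
        rw [this, ENNReal.rpow_one]
      have h2 : g z ^ (2 * (1 / q)) * g z ^ (2 * (1 / 2 - 1 / q)) = g z := by
        rw [← ENNReal.rpow_add_of_nonneg _ _ (by positivity) (by positivity)]
        have : 2 * (1 / q) + 2 * (1 / 2 - 1 / q) = 1 := by ring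
        rw [this, ENNReal.rpow_one]
      calc g z * k = (g z ^ (2 * (1 / q)) * g z ^ (2 * (1 / 2 - 1 / q))) *
            (k ^ (r * (1 / q)) * k ^ (r * (1 / 2))) := by rw [h1, h2]
        _ = _ := by ring
    · gcongr
      exact hker x hx
  have hpow : ∀ x ∈ S, (∫⁻ z in S, g z * ENNReal.ofReal ‖z - x‖⁻¹) ^ q ≤
      (A ^ (q / 2) * G ^ (q / 2 - 1)) *
      (∫⁻ z in S, (ENNReal.ofReal ‖z - x‖⁻¹) ^ r * g z ^ (2:ℝ)) := by
    intro x hx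
    refine (ENNReal.rpow_le_rpow (hold x hx) hq0.le).trans (le_of_eq ?_)
    rw [ENNReal.mul_rpow_of_nonneg _ _ hq0.le, ENNReal.mul_rpow_of_nonneg _ _ hq0.le,
      ← ENNReal.rpow_mul, ← ENNReal.rpow_mul, ← ENNReal.rpow_mul]
    have a1 : 1 / q * q = 1 := by field_simp
    have a2 : 1 / 2 * q = q / 2 := by ring
    have a3 : (1 / 2 - 1 / q) * q = q / 2 - 1 := by field_simp
    rw [a1, a2, a3, ENNReal.rpow_one]
    ring
  have hKg : Measurable (fun p : (ℝ × ℝ) × (ℝ × ℝ) =>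
      (ENNReal.ofReal ‖p.2 - p.1‖⁻¹) ^ r * g p.2 ^ (2:ℝ)) :=
    hKm.mul ((hg.comp measurable_snd).pow_const _)
  have hdouble : ∫⁻ x in S, ∫⁻ z in S, (ENNReal.ofReal ‖z - x‖⁻¹) ^ r * g z ^ (2:ℝ) ≤ A * G := by
    rw [lintegral_lintegral_swap hKg.aemeasurable, hG, ← lintegral_const_mul _ (by fun_prop)]
    refine setLIntegral_mono' hSm fun z hz => ?_
    rw [lintegral_mul_const _ (by fun_prop)]
    gcongr
    simp_rw [norm_sub_rev z]
    exact hker z hz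
  have hmain : ∫⁻ x in S, (∫⁻ z in S, g z * ENNReal.ofReal ‖z - x‖⁻¹) ^ q ≤
      A ^ (q / 2 + 1) * G ^ (q / 2) := by
    calc _ ≤ ∫⁻ x in S, (A ^ (q / 2) * G ^ (q / 2 - 1)) *
      (∫⁻ z in S, (ENNReal.ofReal ‖z - x‖⁻¹) ^ r * g z ^ (2:ℝ)) := setLIntegral_mono' hSm hpow
      _ = (A ^ (q / 2) * G ^ (q / 2 - 1)) * ∫⁻ x in S,
      (∫⁻ z in S, (ENNReal.ofReal ‖z - x‖⁻¹) ^ r * g z ^ (2:ℝ)) :=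
        lintegral_const_mul _ hKg.lintegral_prod_right'
      _ ≤ (A ^ (q / 2) * G ^ (q / 2 - 1)) * (A * G) := by gcongr
      _ = _ := by
        have b1 : A ^ (q / 2 + 1) = A ^ (q / 2) * A := by
          rw [ENNReal.rpow_add_of_nonneg _ _ (by positivity) zero_le_one, ENNReal.rpow_one]
        have b2 : G ^ (q / 2) = G ^ (q / 2 - 1) * G := by
          conv_rhs => rw [← ENNReal.rpow_one G, ← ENNReal.rpow_mul]
          rw [one_mul, ← ENNReal.rpow_add_of_nonneg _ _ (by linarith) zero_le_one]
          congr 1; ring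
        rw [b1, b2]; ring
  refine (ENNReal.rpow_le_rpow hmain (by positivity)).trans (le_of_eq ?_)
  rw [ENNReal.mul_rpow_of_nonneg _ _ (by positivity), ← ENNReal.rpow_mul, ← ENNReal.rpow_mul]
  congr 2 <;> field_simp

lemma ftc_bound (f : ℝ × ℝ → ℝ) (hf : ContDiff ℝ 1 f) (x y : ℝ × ℝ) :
    ‖f y - f x‖ₑ ≤ ∫⁻ t in Set.Ioc (0:ℝ) 1,
      ‖fderiv ℝ f (x + t • (y - x))‖ₑ * ENNReal.ofReal ‖y - x‖ := by
  have hc : Continuous (fderiv ℝ f) := hf.continuous_fderiv one_ne_zero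
  have hd : ∀ t : ℝ, HasDerivAt (fun t : ℝ => f (x + t • (y - x)))
      (fderiv ℝ f (x + t • (y - x)) (y - x)) t := by
    intro t
    have h1 : HasDerivAt (fun t : ℝ => x + t • (y - x)) (y - x) t := by
      simpa using ((hasDerivAt_id t).smul_const (y - x)).const_add x
    exact ((hf.differentiable one_ne_zero _).hasFDerivAt).comp_hasDerivAt t h1
  have hcont : Continuous (fun t : ℝ => fderiv ℝ f (x + t • (y - x)) (y - x)) := by
    exact (hc.comp (by fun_prop)).clm_apply continuous_const
  have := intervalIntegral.integral_eq_sub_of_hasDerivAt (a := 0) (b := 1) (fun t _ => hd t)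
    (hcont.intervalIntegrable _ _)
  simp only [one_smul, zero_smul, add_zero, add_sub_cancel] at this
  rw [← this, intervalIntegral.integral_of_le zero_le_one]
  refine (enorm_integral_le_lintegral_enorm _).trans (lintegral_mono fun t => ?_)
  simp only [ofReal_norm]
  exact ContinuousLinearMap.le_opENorm _ _

lemma pointwise (f : ℝ × ℝ → ℝ) (hf : ContDiff ℝ 1 f) (x : ℝ × ℝ)
    (hx : x ∈ Set.Icc ((0 : ℝ), (0 : ℝ)) (1, 1)) :
    ‖f x‖ₑ ≤ (∫⁻ z in Set.Icc ((0 : ℝ), (0 : ℝ)) (1, 1), ‖f z‖ₑ ^ (2:ℝ)) ^ (1 / 2 : ℝ) +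
      ∫⁻ z in Set.Icc ((0 : ℝ), (0 : ℝ)) (1, 1), ‖fderiv ℝ f z‖ₑ * ENNReal.ofReal ‖z - x‖⁻¹ := by
  have hc : Continuous (fderiv ℝ f) := hf.continuous_fderiv one_ne_zero
  have hfc : Continuous f := hf.continuous
  have hvol : volume (Set.Icc ((0 : ℝ), (0 : ℝ)) (1, 1)) = 1 := by
    rw [← Set.Icc_prod_Icc, Measure.volume_eq_prod, Measure.prod_prod]
    simp
  have hp := potential (fun z => ‖fderiv ℝ f z‖ₑ) hc.enorm.measurable x hx
  set S := Set.Icc ((0 : ℝ), (0 : ℝ)) (1, 1) with hS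
  have hfm : Measurable (fun y => ‖f y‖ₑ) := hfc.enorm.measurable
  calc ‖f x‖ₑ = ∫⁻ y in S, ‖f x‖ₑ := by simp [hvol]
    _ ≤ ∫⁻ y in S, (‖f y‖ₑ + ‖f y - f x‖ₑ) := by
        refine lintegral_mono fun y => ?_
        have : f x = f y - (f y - f x) := by ring
        conv_lhs => rw [this]
        exact enorm_sub_le
    _ = (∫⁻ y in S, ‖f y‖ₑ) + ∫⁻ y in S, ‖f y - f x‖ₑ := lintegral_add_left hfm _
    _ ≤ _ := by
        gcongr ?_ + ?_
        · have h := ENNReal.lintegral_mul_le_Lp_mul_Lq (volume.restrict S) Real.HolderConjugate.two_two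
            hfm.aemeasurable (aemeasurable_const (b := (1 : ENNReal)))
          simpa [hvol] using h
        · exact (lintegral_mono fun y => ftc_bound f hf x y).trans hp

lemma lq_bound (f : ℝ × ℝ → ℝ) (hf : ContDiff ℝ 1 f) (q : ℝ) (hq : 2 < q) :
    (∫⁻ x in Set.Icc ((0 : ℝ), (0 : ℝ)) (1, 1), ‖f x‖ₑ ^ q) ^ (1 / q) ≤
    (∫⁻ z in Set.Icc ((0 : ℝ), (0 : ℝ)) (1, 1), ‖f z‖ₑ ^ (2:ℝ)) ^ (1 / 2 : ℝ) +
     ENNReal.ofReal (4 * q) ^ (1 / 2 + 1 / q : ℝ) *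
      (∫⁻ z in Set.Icc ((0 : ℝ), (0 : ℝ)) (1, 1), ‖fderiv ℝ f z‖ₑ ^ (2:ℝ)) ^ (1 / 2 : ℝ) := by
  have hc : Continuous (fderiv ℝ f) := hf.continuous_fderiv one_ne_zero
  have hvol : volume (Set.Icc ((0 : ℝ), (0 : ℝ)) (1, 1)) = 1 := by
    rw [← Set.Icc_prod_Icc, Measure.volume_eq_prod, Measure.prod_prod]
    simp
  have hgm : Measurable (fun z => ‖fderiv ℝ f z‖ₑ) := hc.enorm.measurable
  have hy := young_bound (fun z => ‖fderiv ℝ f z‖ₑ) hgm q hq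
  have hpw := pointwise f hf
  set S := Set.Icc ((0 : ℝ), (0 : ℝ)) (1, 1) with hS
  set F := (∫⁻ z in S, ‖f z‖ₑ ^ (2:ℝ)) ^ (1 / 2 : ℝ)
  set P : ℝ × ℝ → ENNReal := fun x => ∫⁻ z in S, ‖fderiv ℝ f z‖ₑ * ENNReal.ofReal ‖z - x‖⁻¹ with hP
  have hPm : Measurable P := by
    have : Measurable (fun p : (ℝ × ℝ) × (ℝ × ℝ) =>
        ‖fderiv ℝ f p.2‖ₑ * ENNReal.ofReal ‖p.2 - p.1‖⁻¹) :=
      (hgm.comp measurable_snd).mul (by fun_prop)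
    exact this.lintegral_prod_right'
  have hq0 : 0 < q := by linarith
  calc _ ≤ (∫⁻ x in S, ((fun _ => F : ℝ × ℝ → ENNReal) + P) x ^ q) ^ (1 / q) := by
        refine ENNReal.rpow_le_rpow (setLIntegral_mono' measurableSet_Icc fun x hx => ?_) (by positivity)
        exact ENNReal.rpow_le_rpow (hpw x hx) hq0.le
    _ ≤ (∫⁻ x in S, F ^ q) ^ (1 / q) + (∫⁻ x in S, P x ^ q) ^ (1 / q) :=
        ENNReal.lintegral_Lp_add_le aemeasurable_const hPm.aemeasurable (by linarith)
    _ ≤ _ := by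
        gcongr ?_ + ?_
        · rw [setLIntegral_const, hvol, mul_one, ← ENNReal.rpow_mul, mul_one_div_cancel hq0.ne',
            ENNReal.rpow_one]

/-- Critical Sobolev embedding in 2D with explicit `√q` dependence:
`‖f‖_{L^q(𝕋²)} ≤ C √q ‖f‖_{H¹(𝕋²)}` for all `q > 2`, with `C` universal. -/
theorem stmt9 : ∃ C : ℝ, 0 < C ∧ ∀ f : ℝ × ℝ → ℝ,
    ContDiff ℝ 1 f → T2Periodic f → ∀ q : ℝ, 2 < q →
      T2LpNorm q f ≤ C * Real.sqrt q * T2H1Norm f := by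
  refine ⟨17, by norm_num, fun f hf _ q hq => ?_⟩
  have hq0 : 0 < q := by linarith
  have hc : Continuous (fderiv ℝ f) := hf.continuous_fderiv one_ne_zero
  have hfc : Continuous f := hf.continuous
  have hb := lq_bound f hf q hq
  have hN0 : 0 ≤ T2H1Norm f := Real.sqrt_nonneg _
  have hint : ∫⁻ x in Set.Icc ((0 : ℝ), (0 : ℝ)) (1, 1), (‖f x‖ₑ ^ (2:ℝ) + ‖fderiv ℝ f x‖ₑ ^ (2:ℝ))
      = ENNReal.ofReal (∫ x in Set.Icc ((0 : ℝ), (0 : ℝ)) (1, 1),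
        (|f x| ^ 2 + ‖fderiv ℝ f x‖ ^ 2)) := by
    rw [ofReal_integral_eq_lintegral_ofReal]
    · refine lintegral_congr fun x => ?_
      rw [ENNReal.ofReal_add (by positivity) (by positivity), ENNReal.ofReal_pow (by positivity),
        ENNReal.ofReal_pow (by positivity), ← Real.norm_eq_abs, ofReal_norm, ofReal_norm]
      norm_cast
    · exact Continuous.integrableOn_Icc (by fun_prop)
    · exact Filter.Eventually.of_forall fun x => by simp only [Pi.zero_apply]; positivity
  have hH : (∫⁻ x in Set.Icc ((0 : ℝ), (0 : ℝ)) (1, 1),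
      (‖f x‖ₑ ^ (2:ℝ) + ‖fderiv ℝ f x‖ₑ ^ (2:ℝ))) ^ (1 / 2 : ℝ) = ENNReal.ofReal (T2H1Norm f) := by
    rw [hint, T2H1Norm, Real.sqrt_eq_rpow, ENNReal.ofReal_rpow_of_nonneg _ (by norm_num)]
    exact integral_nonneg fun x => by positivity
  have hL : ENNReal.ofReal (T2LpNorm q f) =
      (∫⁻ x in Set.Icc ((0 : ℝ), (0 : ℝ)) (1, 1), ‖f x‖ₑ ^ q) ^ (1 / q) := by
    rw [T2LpNorm, ← ENNReal.ofReal_rpow_of_nonneg (integral_nonneg fun x => by positivity)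
      (by positivity), ofReal_integral_eq_lintegral_ofReal]
    · congr 1
      refine lintegral_congr fun x => ?_
      rw [← ENNReal.ofReal_rpow_of_nonneg (by positivity) hq0.le, ← Real.norm_eq_abs, ofReal_norm]
    · exact Continuous.integrableOn_Icc (hfc.abs.rpow_const fun _ => Or.inr hq0.le)
    · exact Filter.Eventually.of_forall fun x => by simp only [Pi.zero_apply]; positivity
  have hF : (∫⁻ z in Set.Icc ((0 : ℝ), (0 : ℝ)) (1, 1), ‖f z‖ₑ ^ (2:ℝ)) ^ (1 / 2 : ℝ)
      ≤ ENNReal.ofReal (T2H1Norm f) := by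
    rw [← hH]
    gcongr
    exact le_self_add
  have hG : (∫⁻ z in Set.Icc ((0 : ℝ), (0 : ℝ)) (1, 1), ‖fderiv ℝ f z‖ₑ ^ (2:ℝ)) ^ (1 / 2 : ℝ)
      ≤ ENNReal.ofReal (T2H1Norm f) := by
    rw [← hH]
    gcongr
    exact le_add_self
  have hconst : (4 * q) ^ (1 / 2 + 1 / q : ℝ) ≤ 16 * Real.sqrt q := by
    have h4 : 0 < 4 * q := by positivity
    rw [Real.rpow_add h4, ← Real.sqrt_eq_rpow, Real.sqrt_mul (by norm_num)]
    have h42 : Real.sqrt 4 = 2 := by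
      rw [show (4:ℝ) = 2 ^ 2 by norm_num]; exact Real.sqrt_sq (by norm_num)
    have hB : 4 * q ≤ (8:ℝ) ^ q := by
      have := one_add_mul_self_le_rpow_one_add (s := 7) (by norm_num) (p := q) (by linarith)
      norm_num at this
      linarith
    have h8 : (4 * q) ^ (1 / q) ≤ 8 := by
      refine (Real.rpow_le_rpow h4.le hB (by positivity)).trans (le_of_eq ?_)
      rw [← Real.rpow_mul (by norm_num), mul_one_div_cancel hq0.ne', Real.rpow_one]
    rw [h42]
    nlinarith [Real.sqrt_nonneg q]
  have hs : 1 ≤ Real.sqrt q := by rw [Real.one_le_sqrt]; linarith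
  rw [← hL] at hb
  have hfin : ENNReal.ofReal (T2LpNorm q f) ≤
      ENNReal.ofReal (T2H1Norm f + (4 * q) ^ (1 / 2 + 1 / q : ℝ) * T2H1Norm f) := by
    rw [ENNReal.ofReal_add hN0 (by positivity), ENNReal.ofReal_mul (by positivity),
      ← ENNReal.ofReal_rpow_of_nonneg (by positivity) (by positivity)]
    refine hb.trans ?_
    gcongr
  rw [ENNReal.ofReal_le_ofReal_iff (by positivity)] at hfin
  nlinarith [mul_le_mul_of_nonneg_right hconst hN0, mul_le_mul_of_nonneg_right hs hN0]
end

section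
/- There exists a constant C > 0 such that for every f ∈ H²(𝕋²), ‖f‖_{L^∞(𝕋²)} ≤ C (1 + ‖f‖_{H¹(𝕋²)}) (log(e + ‖f‖_{H²(𝕋²)}))^{1/2}. -/
open MeasureTheory

/-- `H²` norm on the 2-torus. -/
noncomputable def T2H2Norm (f : ℝ × ℝ → ℝ) : ℝ :=
  Real.sqrt (∫ x in Set.Icc ((0 : ℝ), (0 : ℝ)) (1, 1),
    (|f x| ^ 2 + ‖fderiv ℝ f x‖ ^ 2 + ‖iteratedFDeriv ℝ 2 f x‖ ^ 2))

lemma bg_young (s a m : ℝ) (hm : 0 < m) (_hs : 0 ≤ s) : s * |a| ≤ (m * a ^ 2 + s ^ 2 / m) / 2 := by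
  have h : m * a ^ 2 + s ^ 2 / m - 2 * (s * |a|) = (m * |a| - s) ^ 2 / m := by
    rw [← sq_abs a]; field_simp; ring
  have : 0 ≤ (m * |a| - s) ^ 2 / m := by positivity
  linarith

lemma bg_oneD (g g1 g2 H : ℝ → ℝ) (hg : ∀ r, HasDerivAt g (g1 r) r)
    (hg1 : ∀ r, HasDerivAt g1 (g2 r) r) (hg2 : Continuous g2) (hHc : Continuous H)
    (e mu la nu : ℝ) (he : 0 < e) (he2 : e ≤ 1 / 2) (hmu : 0 < mu) (hla : 0 < la) (hnu : 0 < nu)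
    (hH : ∀ r, 4 * mu * (g r) ^ 2 + la * (g1 r) ^ 2 + nu / 2 * (g2 r) ^ 2 ≤ H r) :
    |g 0| ≤ (∫ r in (0 : ℝ)..(1 / 2), r * H r) +
      (1 / (2 * mu) + 1 / (2 * la) + e ^ 2 / (4 * nu) + 1 / (2 * la) * Real.log (1 / 2 / e)) := by
  have cg : Continuous g := continuous_iff_continuousAt.2 fun r => (hg r).continuousAt
  have cg1 : Continuous g1 := continuous_iff_continuousAt.2 fun r => (hg1 r).continuousAt
  have I1 : ∫ r in (0 : ℝ)..e, (8 * r * g r + (4 * r ^ 2 - 2 * r / e) * g1 r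
      + (r - r ^ 2 / e) * g2 r) = (4 * e ^ 2 - 1) * g e + g 0 := by
    rw [intervalIntegral.integral_eq_sub_of_hasDerivAt
      (f := fun r => (4 * r ^ 2 - 1) * g r + (r - r ^ 2 / e) * g1 r)]
    · field_simp; ring
    · intro r _
      have h1 : HasDerivAt (fun r : ℝ => 4 * r ^ 2 - 1) (8 * r) r := by
        have := ((hasDerivAt_pow 2 r).const_mul 4).sub_const 1
        exact this.congr_deriv (by norm_num; ring)
      have h2 : HasDerivAt (fun r : ℝ => r - r ^ 2 / e) (1 - 2 * r / e) r := by
        have := (hasDerivAt_id r).sub ((hasDerivAt_pow 2 r).div_const e)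
        exact this.congr_deriv (by norm_num)
      have := (h1.mul (hg r)).add (h2.mul (hg1 r))
      exact this.congr_deriv (by ring)
    · apply Continuous.intervalIntegrable; fun_prop
  have I2 : ∫ r in e..(1 / 2), (8 * r * g r + (4 * r ^ 2 - 1) * g1 r)
      = - ((4 * e ^ 2 - 1) * g e) := by
    rw [intervalIntegral.integral_eq_sub_of_hasDerivAt
      (f := fun r => (4 * r ^ 2 - 1) * g r)]
    · ring
    · intro r _
      have h1 : HasDerivAt (fun r : ℝ => 4 * r ^ 2 - 1) (8 * r) r := by
        have := ((hasDerivAt_pow 2 r).const_mul 4).sub_const 1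
        exact this.congr_deriv (by norm_num; ring)
      exact h1.mul (hg r)
    · apply Continuous.intervalIntegrable; fun_prop
  have B1 := intervalIntegral.norm_integral_le_of_norm_le (μ := volume) (a := 0) (b := e) he.le
    (f := fun r => 8 * r * g r + (4 * r ^ 2 - 2 * r / e) * g1 r + (r - r ^ 2 / e) * g2 r)
    (g := fun r => r * H r + r * (4 / mu + 1 / (la * e ^ 2) + 1 / (2 * nu)))
    (Filter.Eventually.of_forall (by
      rintro r ⟨h0, h1⟩
      have y1 := bg_young 1 (g r) mu hmu zero_le_one
      have y2 := bg_young (1 / e) (g1 r) la hla (by positivity)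
      have y3 := bg_young 1 (g2 r) nu hnu zero_le_one
      have k1 : |4 * r ^ 2 - 2 * r / e| ≤ r * (2 / e) := by
        have : 2 * r / e = r * (2 / e) := by ring
        have h3 : 4 * r ≤ 2 * (2 / e) := by
          have : 2 ≤ 1 / e := by rw [le_div_iff₀ he]; linarith
          have : 2 / e = 2 * (1 / e) := by ring
          linarith
        rw [this, abs_le]; constructor <;> nlinarith
      have k2 : |r - r ^ 2 / e| ≤ r := by
        have : r ^ 2 / e ≤ r := by rw [div_le_iff₀ he]; nlinarith
        have : 0 ≤ r ^ 2 / e := by positivity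
        rw [abs_le]; constructor <;> linarith
      have t1 : ‖8 * r * g r + (4 * r ^ 2 - 2 * r / e) * g1 r + (r - r ^ 2 / e) * g2 r‖
          ≤ 8 * r * |g r| + r * (2 / e) * |g1 r| + r * |g2 r| := by
        rw [Real.norm_eq_abs]
        refine (abs_add_three _ _ _).trans ?_
        rw [abs_mul, abs_mul (4 * r ^ 2 - 2 * r / e), abs_mul (r - r ^ 2 / e),
          abs_of_nonneg (by positivity : 0 ≤ 8 * r)]
        gcongr
      refine t1.trans ?_
      have hh := hH r
      have e1 : (1 / e) ^ 2 / la = 1 / (la * e ^ 2) := by field_simp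
      have e2 : (4 : ℝ) / mu = 4 * (1 ^ 2 / mu) := by ring
      have e3 : 1 / (2 * nu) = (1 ^ 2 / nu) / 2 := by field_simp
      have e4 : 2 / e = 2 * (1 / e) := by ring
      have : 8 * |g r| + (2 / e) * |g1 r| + |g2 r| ≤
          H r + (4 / mu + 1 / (la * e ^ 2) + 1 / (2 * nu)) := by
        rw [← e1, e2, e3, e4]; linarith
      nlinarith [mul_le_mul_of_nonneg_left this h0.le]))
    (by apply Continuous.intervalIntegrable; fun_prop)
  have ci : IntervalIntegrable (fun r : ℝ => 1 / r) volume e (1 / 2) := by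
    apply ContinuousOn.intervalIntegrable
    intro r hr
    rw [Set.uIcc_of_le he2] at hr
    exact (continuousAt_const.div continuousAt_id (by have := hr.1; simp; linarith)).continuousWithinAt
  have cj : IntervalIntegrable (fun r : ℝ => r * H r) volume e (1 / 2) := by
    apply Continuous.intervalIntegrable; fun_prop
  have ck : IntervalIntegrable (fun r : ℝ => r * (4 / mu)) volume e (1 / 2) := by
    apply Continuous.intervalIntegrable; fun_prop
  have B2 := intervalIntegral.norm_integral_le_of_norm_le (μ := volume) (a := e) (b := 1 / 2) he2
    (f := fun r => 8 * r * g r + (4 * r ^ 2 - 1) * g1 r)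
    (g := fun r => r * H r + r * (4 / mu) + 1 / (2 * la) * (1 / r))
    (Filter.Eventually.of_forall (by
      rintro r ⟨h0', h1⟩
      have h0 : 0 < r := he.trans h0'
      have y1 := bg_young 1 (g r) mu hmu zero_le_one
      have y2 := bg_young 1 (g1 r) (la * r) (by positivity) zero_le_one
      have k1 : |4 * r ^ 2 - 1| ≤ 1 := by
        rw [abs_le]; constructor <;> nlinarith
      have t1 : ‖8 * r * g r + (4 * r ^ 2 - 1) * g1 r‖
          ≤ 8 * r * |g r| + 1 * |g1 r| := by
        rw [Real.norm_eq_abs]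
        refine (abs_add_le _ _).trans ?_
        rw [abs_mul, abs_mul (4 * r ^ 2 - 1),
          abs_of_nonneg (by positivity : 0 ≤ 8 * r)]
        gcongr
      refine t1.trans ?_
      have hh : 4 * mu * (g r) ^ 2 + la * (g1 r) ^ 2 ≤ H r := by
        have : 0 ≤ nu / 2 * (g2 r) ^ 2 := by positivity
        linarith [hH r]
      have e2 : (4 : ℝ) / mu = 4 * (1 ^ 2 / mu) := by ring
      have e3 : 1 / (2 * la) * (1 / r) = (1 ^ 2 / (la * r)) / 2 := by field_simp
      have hla' : 0 ≤ la * g1 r ^ 2 * r := by positivity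
      rw [e2, e3]
      nlinarith [mul_le_mul_of_nonneg_left hh h0.le, mul_le_mul_of_nonneg_left y1 h0.le]))
    ((cj.add ck).add (ci.const_mul _))
  rw [I1] at B1
  rw [I2] at B2
  have J1 : ∫ r in (0 : ℝ)..e, (r * H r + r * (4 / mu + 1 / (la * e ^ 2) + 1 / (2 * nu))) =
      (∫ r in (0 : ℝ)..e, r * H r) + e ^ 2 / 2 * (4 / mu + 1 / (la * e ^ 2) + 1 / (2 * nu)) := by
    rw [intervalIntegral.integral_add, intervalIntegral.integral_mul_const, integral_id]
    · ring
    · apply Continuous.intervalIntegrable; fun_prop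
    · apply Continuous.intervalIntegrable; fun_prop
  have J2 : ∫ r in e..(1 / 2), (r * H r + r * (4 / mu) + 1 / (2 * la) * (1 / r)) =
      (∫ r in e..(1 / 2), r * H r) + ((1 / 2) ^ 2 - e ^ 2) / 2 * (4 / mu)
        + 1 / (2 * la) * Real.log (1 / 2 / e) := by
    rw [intervalIntegral.integral_add (cj.add ck) (ci.const_mul _),
      intervalIntegral.integral_add cj ck, intervalIntegral.integral_mul_const, integral_id,
      intervalIntegral.integral_const_mul, integral_one_div_of_pos he (by norm_num)]
  rw [J1] at B1
  rw [J2] at B2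
  have J3 : (∫ r in (0 : ℝ)..e, r * H r) + (∫ r in e..(1 / 2), r * H r)
      = ∫ r in (0 : ℝ)..(1 / 2), r * H r := by
    apply intervalIntegral.integral_add_adjacent_intervals _ cj
    apply Continuous.intervalIntegrable; fun_prop
  have T : |g 0| ≤ ‖(4 * e ^ 2 - 1) * g e + g 0‖ + ‖-((4 * e ^ 2 - 1) * g e)‖ := by
    refine le_trans (le_of_eq ?_) (norm_add_le _ _)
    rw [Real.norm_eq_abs]; congr 1; ring
  have S : e ^ 2 / 2 * (4 / mu + 1 / (la * e ^ 2) + 1 / (2 * nu)) +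
      ((1 / 2) ^ 2 - e ^ 2) / 2 * (4 / mu) = 1 / (2 * mu) + 1 / (2 * la) + e ^ 2 / (4 * nu) := by
    field_simp; ring
  linarith

lemma bg_shift (φ : ℝ → ℝ) (hφ : Continuous φ) (h0 : ∀ y, 0 ≤ φ y) (x s r : ℝ)
    (hs : s = 1 ∧ 0 ≤ x ∧ x ≤ 1 / 2 ∨ s = -1 ∧ 1 / 2 ≤ x ∧ x ≤ 1) (hr0 : 0 ≤ r) (hr : r ≤ 1 / 2) :
    ∫ u in (0 : ℝ)..r, φ (x + s * u) ≤ ∫ u in (0 : ℝ)..1, φ u := by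
  rcases hs with ⟨rfl, h1, h2⟩ | ⟨rfl, h1, h2⟩
  · have : ∫ u in (0 : ℝ)..r, φ (x + 1 * u) = ∫ u in x..(x + r), φ u := by
      simp only [one_mul]
      rw [intervalIntegral.integral_comp_add_left (fun u => φ u), add_zero]
    rw [this]
    exact intervalIntegral.integral_mono_interval h1 (by linarith) (by linarith)
      (Filter.Eventually.of_forall h0) (hφ.intervalIntegrable _ _)
  · have : ∫ u in (0 : ℝ)..r, φ (x + (-1) * u) = ∫ u in (x - r)..x, φ u := by
      simp only [neg_mul, one_mul, ← sub_eq_add_neg]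
      rw [intervalIntegral.integral_comp_sub_left (fun u => φ u), sub_zero]
    rw [this]
    exact intervalIntegral.integral_mono_interval (by linarith) (by linarith) (by linarith)
      (Filter.Eventually.of_forall h0) (hφ.intervalIntegrable _ _)

lemma bg_square (H : ℝ × ℝ → ℝ) (hH : Continuous H) :
    ∫ u in (0 : ℝ)..1, ∫ v in (0 : ℝ)..1, H (u, v) = ∫ p in Set.Icc ((0 : ℝ), (0 : ℝ)) (1, 1), H p := by
  rw [← Set.Icc_prod_Icc, Measure.volume_eq_prod, setIntegral_prod]
  · rw [intervalIntegral.integral_of_le zero_le_one, integral_Icc_eq_integral_Ioc]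
    congr 1; ext u
    rw [intervalIntegral.integral_of_le zero_le_one, integral_Icc_eq_integral_Ioc]
  · rw [Set.Icc_prod_Icc, ← Measure.volume_eq_prod]
    exact hH.continuousOn.integrableOn_compact isCompact_Icc

lemma bg_twoD (H : ℝ × ℝ → ℝ) (hH : Continuous H) (h0 : ∀ y, 0 ≤ H y) (x y s s' : ℝ)
    (hs : s = 1 ∧ 0 ≤ x ∧ x ≤ 1 / 2 ∨ s = -1 ∧ 1 / 2 ≤ x ∧ x ≤ 1)
    (hs' : s' = 1 ∧ 0 ≤ y ∧ y ≤ 1 / 2 ∨ s' = -1 ∧ 1 / 2 ≤ y ∧ y ≤ 1) :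
    ∫ t in (0 : ℝ)..1, ∫ r in (0 : ℝ)..(1 / 2), r * H (x + r * s, y + r * (s' * t)) ≤
      ∫ p in Set.Icc ((0 : ℝ), (0 : ℝ)) (1, 1), H p := by
  rw [intervalIntegral_intervalIntegral_swap, ← bg_square H hH]
  · have cφ : Continuous fun u => ∫ v in (0 : ℝ)..1, H (u, v) :=
      intervalIntegral.continuous_parametric_intervalIntegral_of_continuous'
        (f := fun u v => H (u, v)) (by fun_prop) 0 1
    refine le_trans ?_ (bg_shift (fun u => ∫ v in (0 : ℝ)..1, H (u, v)) cφ
      (fun u => intervalIntegral.integral_nonneg zero_le_one fun v _ => h0 _) x s (1 / 2) hs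
      (by norm_num) le_rfl)
    apply intervalIntegral.integral_mono_on (by norm_num)
    · apply Continuous.intervalIntegrable
      exact intervalIntegral.continuous_parametric_intervalIntegral_of_continuous'
        (f := fun r t => r * H (x + r * s, y + r * (s' * t))) (by fun_prop) 0 1
    · apply Continuous.intervalIntegrable
      exact cφ.comp (by fun_prop)
    · intro r hr
      have := bg_shift (fun v => H (x + s * r, v)) (by fun_prop) (fun _ => h0 _) y s' r hs' hr.1 hr.2
      refine le_trans (le_of_eq ?_) this
      rw [intervalIntegral.integral_const_mul]
      have h := intervalIntegral.mul_integral_comp_mul_left (a := 0) (b := 1)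
        (f := fun u => H (x + s * r, y + s' * u)) r
      rw [mul_zero, mul_one] at h
      rw [← h]
      congr 2; ext t; congr 2 <;> ring
  · have hc : Continuous (Function.uncurry
        fun t r : ℝ => r * H (x + r * s, y + r * (s' * t))) := by fun_prop
    refine (hc.continuousOn.integrableOn_compact (isCompact_uIcc.prod isCompact_uIcc)).mono_set
      (Set.prod_mono Set.uIoc_subset_uIcc Set.uIoc_subset_uIcc)

lemma bg_core (f : ℝ × ℝ → ℝ) (hf : ContDiff ℝ 2 f) (x y : ℝ) (hx : 0 ≤ x ∧ x ≤ 1)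
    (hy : 0 ≤ y ∧ y ≤ 1) :
    |f (x, y)| ≤ 10 * (1 + T2H1Norm f) *
        Real.sqrt (Real.log (Real.exp 1 + T2H2Norm f)) := by
  obtain ⟨s, hs⟩ : ∃ s : ℝ, s = 1 ∧ 0 ≤ x ∧ x ≤ 1 / 2 ∨ s = -1 ∧ 1 / 2 ≤ x ∧ x ≤ 1 := by
    rcases le_total x (1 / 2) with h | h
    · exact ⟨1, Or.inl ⟨rfl, hx.1, h⟩⟩
    · exact ⟨-1, Or.inr ⟨rfl, h, hx.2⟩⟩
  obtain ⟨s', hs'⟩ : ∃ s : ℝ, s = 1 ∧ 0 ≤ y ∧ y ≤ 1 / 2 ∨ s = -1 ∧ 1 / 2 ≤ y ∧ y ≤ 1 := by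
    rcases le_total y (1 / 2) with h | h
    · exact ⟨1, Or.inl ⟨rfl, hy.1, h⟩⟩
    · exact ⟨-1, Or.inr ⟨rfl, h, hy.2⟩⟩
  have hs1 : |s| = 1 := by rcases hs with ⟨rfl, _⟩ | ⟨rfl, _⟩ <;> simp
  have hs1' : |s'| = 1 := by rcases hs' with ⟨rfl, _⟩ | ⟨rfl, _⟩ <;> simp
  have c0 : Continuous f := hf.continuous
  have c1 : Continuous (fderiv ℝ f) := hf.continuous_fderiv (by norm_num)
  have c2 : Continuous (iteratedFDeriv ℝ 2 f) := hf.continuous_iteratedFDeriv (by norm_num)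
  set F1 : ℝ × ℝ → ℝ := fun x => |f x| ^ 2 + ‖fderiv ℝ f x‖ ^ 2 with hF1
  set F2 : ℝ × ℝ → ℝ := fun x => |f x| ^ 2 + ‖fderiv ℝ f x‖ ^ 2 + ‖iteratedFDeriv ℝ 2 f x‖ ^ 2 with hF2
  have cF1 : Continuous F1 := by fun_prop
  have cF2 : Continuous F2 := by fun_prop
  have pF1 : ∀ z, 0 ≤ F1 z := fun z => by positivity
  have pF2 : ∀ z, 0 ≤ F2 z := fun z => by positivity
  have hA : T2H1Norm f ^ 2 = ∫ p in Set.Icc ((0 : ℝ), (0 : ℝ)) (1, 1), F1 p :=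
    Real.sq_sqrt (integral_nonneg pF1)
  have hB : T2H2Norm f ^ 2 = ∫ p in Set.Icc ((0 : ℝ), (0 : ℝ)) (1, 1), F2 p :=
    Real.sq_sqrt (integral_nonneg pF2)
  have A0 : 0 ≤ T2H1Norm f := Real.sqrt_nonneg _
  have B0 : 0 ≤ T2H2Norm f := Real.sqrt_nonneg _
  set A := T2H1Norm f
  set B := T2H2Norm f
  have hL1 : 1 ≤ Real.log (Real.exp 1 + B) := by
    rw [Real.le_log_iff_exp_le (by positivity)]; linarith
  have hL2 : Real.log (1 + B) ≤ Real.log (Real.exp 1 + B) := by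
    apply Real.log_le_log (by positivity)
    have := Real.add_one_le_exp (1 : ℝ); linarith
  set L := Real.log (Real.exp 1 + B)
  have hq : Real.sqrt L ^ 2 = L := Real.sq_sqrt (by linarith)
  have hq1 : 1 ≤ Real.sqrt L := Real.one_le_sqrt.2 hL1
  set q := Real.sqrt L
  have main : ∀ mu la nu e : ℝ, 0 < mu → 0 < la → 0 < nu → 0 < e → e ≤ 1 / 2 →
      |f (x, y)| ≤ (4 * mu + la) * A ^ 2 + nu / 2 * B ^ 2 +
      (1 / (2 * mu) + 1 / (2 * la) + e ^ 2 / (4 * nu) + 1 / (2 * la) * Real.log (1 / 2 / e)) := by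
    intro mu la nu e hmu hla hnu he he2
    set Q := (1 / (2 * mu) + 1 / (2 * la) + e ^ 2 / (4 * nu) + 1 / (2 * la) * Real.log (1 / 2 / e))
    set H : ℝ × ℝ → ℝ := fun z => (4 * mu + la) * F1 z + nu / 2 * F2 z with hHdef
    have cH : Continuous H := by fun_prop
    have pH : ∀ z, 0 ≤ H z := fun z => by
      have := pF1 z; have := pF2 z; positivity
    have key : ∀ t ∈ Set.Icc (0 : ℝ) 1, |f (x, y)| - Q ≤
        ∫ r in (0 : ℝ)..(1 / 2), r * H (x + r * s, y + r * (s' * t)) := by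
      intro t ht
      set v : ℝ × ℝ := (s, s' * t) with hv
      have nv : ‖v‖ ≤ 1 := by
        rw [hv, Prod.norm_def]
        simp only [Real.norm_eq_abs, abs_mul, hs1, hs1', one_mul]
        rw [abs_of_nonneg ht.1]; exact max_le le_rfl ht.2
      set p : ℝ → ℝ × ℝ := fun r => (x + r * s, y + r * (s' * t)) with hp
      have hpd : ∀ r, HasDerivAt p v r := by
        intro r
        apply HasDerivAt.prodMk
        · simpa using ((hasDerivAt_id r).mul_const s).const_add x
        · simpa using ((hasDerivAt_id r).mul_const (s' * t)).const_add y
      have cp : Continuous p := by fun_prop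
      have d1 : Differentiable ℝ f := hf.differentiable (by norm_num)
      have d2 : Differentiable ℝ (fderiv ℝ f) :=
        (hf.fderiv_right (m := 1) (by norm_num)).differentiable (by norm_num)
      have := bg_oneD (fun r => f (p r)) (fun r => fderiv ℝ f (p r) v)
        (fun r => iteratedFDeriv ℝ 2 f (p r) ![v, v]) (fun r => H (p r))
        (fun r => (d1 (p r)).hasFDerivAt.comp_hasDerivAt r (hpd r))
        (fun r => by
          have h := (d2 (p r)).hasFDerivAt.comp_hasDerivAt r (hpd r)
          have h2 := h.clm_apply (hasDerivAt_const r v)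
          rw [iteratedFDeriv_two_apply]
          simpa using h2)
        (by
          simp only [iteratedFDeriv_two_apply]
          have : Continuous (fderiv ℝ (fderiv ℝ f)) :=
            (hf.fderiv_right (m := 1) (by norm_num)).continuous_fderiv (by norm_num)
          fun_prop)
        (cH.comp cp) e mu la nu he he2 hmu hla hnu
        (fun r => by
          have b1 : (fderiv ℝ f (p r) v) ^ 2 ≤ ‖fderiv ℝ f (p r)‖ ^ 2 := by
            rw [← sq_abs]
            gcongr
            exact ((fderiv ℝ f (p r)).le_opNorm v).trans
              (mul_le_of_le_one_right (norm_nonneg _) nv)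
          have b2 : (iteratedFDeriv ℝ 2 f (p r) ![v, v]) ^ 2 ≤ ‖iteratedFDeriv ℝ 2 f (p r)‖ ^ 2 := by
            rw [← sq_abs]
            gcongr
            refine ((iteratedFDeriv ℝ 2 f (p r)).le_opNorm _).trans
              (mul_le_of_le_one_right (norm_nonneg _) ?_)
            simp only [Fin.prod_univ_two, Matrix.cons_val_zero, Matrix.cons_val_one]
            exact mul_le_one₀ nv (norm_nonneg _) nv
          have m1 := mul_le_mul_of_nonneg_left b1 hla.le
          have m2 := mul_le_mul_of_nonneg_left b2 (half_pos hnu).le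
          have n1 : 0 ≤ la * |f (p r)| ^ 2 := by positivity
          have n2 : 0 ≤ mu * ‖fderiv ℝ f (p r)‖ ^ 2 := by positivity
          have n3 : 0 ≤ nu / 2 * (|f (p r)| ^ 2 + ‖fderiv ℝ f (p r)‖ ^ 2) := by positivity
          simp only [hHdef, hF1, hF2]
          rw [← sq_abs (f (p r))]
          linarith)
      have p0 : p 0 = (x, y) := by simp [hp]
      simp only [p0] at this
      linarith
    have K := intervalIntegral.integral_mono_on (μ := volume) (zero_le_one' ℝ)
      (f := fun _ => |f (x, y)| - Q) (by simp)
      (Continuous.intervalIntegrable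
        (intervalIntegral.continuous_parametric_intervalIntegral_of_continuous'
        (f := fun t r => r * H (x + r * s, y + r * (s' * t))) (by fun_prop) 0 (1 / 2)) _ _) key
    have K2 := bg_twoD H cH pH x y s s' hs hs'
    have K3 : ∫ p in Set.Icc ((0 : ℝ), (0 : ℝ)) (1, 1), H p =
        (4 * mu + la) * A ^ 2 + nu / 2 * B ^ 2 := by
      rw [hA, hB, ← integral_const_mul, ← integral_const_mul, ← integral_add]
      · apply Continuous.integrableOn_Icc; fun_prop
      · apply Continuous.integrableOn_Icc; fun_prop
    simp only [intervalIntegral.integral_const, sub_zero, one_smul] at K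
    linarith
  have := main (1 / (1 + A)) (q / (1 + A)) (1 / (1 + B) ^ 2) (1 / (2 * (1 + B)))
    (by positivity) (by positivity) (by positivity) (by positivity)
    (by apply one_div_le_one_div_of_le <;> linarith)
  have r1 : (1 : ℝ) / 2 / (1 / (2 * (1 + B))) = 1 + B := by field_simp
  rw [r1] at this
  have hM : A ^ 2 / (1 + A) ≤ 1 + A := by rw [div_le_iff₀ (by positivity)]; nlinarith
  have hN : B ^ 2 / (1 + B) ^ 2 ≤ 1 := by rw [div_le_one (by positivity)]; nlinarith
  have z1 : (4 * (1 / (1 + A)) + q / (1 + A)) * A ^ 2 = (4 + q) * (A ^ 2 / (1 + A)) := by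
    field_simp
  have z2 : 1 / (1 + B) ^ 2 / 2 * B ^ 2 = (B ^ 2 / (1 + B) ^ 2) / 2 := by field_simp
  have z3 : 1 / (2 * (1 / (1 + A))) = (1 + A) / 2 := by field_simp
  have z4 : (1 / (2 * (1 + B))) ^ 2 / (4 * (1 / (1 + B) ^ 2)) = 1 / 16 := by field_simp; norm_num
  have z5 : 1 / (2 * (q / (1 + A))) = (1 + A) * (1 / (2 * q)) := by field_simp
  have z6 : 1 / (2 * q) * (1 + Real.log (1 + B)) ≤ q := by
    rw [one_div, inv_mul_le_iff₀ (by positivity)]; nlinarith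
  rw [z1, z2, z3, z4, z5] at this
  have w1 := mul_le_mul_of_nonneg_left hM (by positivity : 0 ≤ 4 + q)
  have w2 := mul_le_mul_of_nonneg_left z6 (by positivity : 0 ≤ 1 + A)
  have w3 := mul_le_mul_of_nonneg_left hq1 (by positivity : 0 ≤ 1 + A)
  nlinarith

/-- Brezis–Gallouet inequality on `𝕋²`:
`‖f‖_∞ ≤ C (1 + ‖f‖_{H¹}) (log (e + ‖f‖_{H²}))^{1/2}`. -/
theorem stmt10 : ∃ C : ℝ, 0 < C ∧ ∀ f : ℝ × ℝ → ℝ,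
    ContDiff ℝ 2 f → T2Periodic f → ∀ x : ℝ × ℝ,
      |f x| ≤ C * (1 + T2H1Norm f) *
        Real.sqrt (Real.log (Real.exp 1 + T2H2Norm f)) := by
  refine ⟨10, by norm_num, fun f hf hper x => ?_⟩
  have p1 : ∀ b, Function.Periodic (fun a => f (a, b)) 1 := fun b a => (hper (a, b)).1
  have p2 : ∀ a, Function.Periodic (fun b => f (a, b)) 1 := fun a b => (hper (a, b)).2
  have e1 : f (Int.fract x.1, Int.fract x.2) = f x := by
    have h1 := (p1 (Int.fract x.2)).sub_int_mul_eq (x := x.1) ⌊x.1⌋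
    have h2 := (p2 x.1).sub_int_mul_eq (x := x.2) ⌊x.2⌋
    simp only [mul_one] at h1 h2
    exact h1.trans h2
  rw [← e1]
  exact bg_core f hf _ _ ⟨Int.fract_nonneg _, (Int.fract_lt_one _).le⟩
    ⟨Int.fract_nonneg _, (Int.fract_lt_one _).le⟩
end
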